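/- Let p be a prime, n ≥ 1, E a field of characteristic zero containing a primitive p^n-th root of unity ζ, and let Q_n(X) = ((1+X)^{p^n} − 1)/((1+X)^{p^{n−1}} − 1), viewed in E[X]. Let f ∈ E[X] be a nonzero polynomial. Then Q_n'(ζ − 1) ≠ 0, the rational function (f'(X)·Q_n(X)) / (f(X)·Q_n'(X)) ∈ E(X) has no pole at X = ζ − 1 (its denominator in lowest terms does not vanish there), and its value at X = ζ − 1 equals the multiplicity of ζ − 1 as a root of f, i.e. it equals the natural number rootMultiplicity(ζ − 1, f) viewed as an element of E. In particular this value is an integer. -/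

import Mathlib

open Polynomial in
theorem Polynomial.ratFuncEval_div_of_eval_ne_zero {E : Type*} [Field E] (a : E) (u v : E[X])
    (hv : v.eval a ≠ 0) :
    (algebraMap E[X] (RatFunc E) u / algebraMap E[X] (RatFunc E) v).denom.eval a ≠ 0 ∧
      RatFunc.eval (RingHom.id E) a
        (algebraMap E[X] (RatFunc E) u / algebraMap E[X] (RatFunc E) v) =
          u.eval a / v.eval a := by
  have hv0 : v ≠ 0 := by
    rintro rfl
    simp at hv
  set r := algebraMap E[X] (RatFunc E) u / algebraMap E[X] (RatFunc E) v with hr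
  have hd : r.denom.eval a ≠ 0 := fun h =>
    hv (eval_eq_zero_of_dvd_of_eval_eq_zero (RatFunc.denom_div_dvd u v) h)
  refine ⟨hd, ?_⟩
  have key : r.num.eval a * v.eval a = u.eval a * r.denom.eval a := by
    rw [← eval_mul, ← eval_mul, (RatFunc.num_mul_eq_mul_denom_iff hv0).mpr hr]
  rw [RatFunc.eval, eval₂_id, eval₂_id, div_eq_div_iff hd hv, key]

open Polynomial in
theorem Polynomial.ratFuncEval_logDeriv_div_logDeriv {E : Type*} [Field E] (a : E) (f q : E[X])
    (hf : f ≠ 0) (hq : q.eval a = 0) (hq' : (derivative q).eval a ≠ 0) :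
    (algebraMap E[X] (RatFunc E) (derivative f * q) /
        algebraMap E[X] (RatFunc E) (f * derivative q)).denom.eval a ≠ 0 ∧
      RatFunc.eval (RingHom.id E) a
        (algebraMap E[X] (RatFunc E) (derivative f * q) /
          algebraMap E[X] (RatFunc E) (f * derivative q)) = (rootMultiplicity a f : E) := by
  obtain ⟨h, rfl⟩ := dvd_iff_isRoot.mpr hq
  obtain ⟨g, hg, hgd⟩ := exists_eq_pow_rootMultiplicity_mul_and_not_dvd f hf a
  set m := rootMultiplicity a f
  have hga : g.eval a ≠ 0 := fun H => hgd (dvd_iff_isRoot.mpr H)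
  have hh : (derivative ((X - C a) * h)).eval a = h.eval a := by simp
  have hpow : algebraMap E[X] (RatFunc E) ((X - C a) ^ m) ≠ 0 :=
    RatFunc.algebraMap_ne_zero (pow_ne_zero _ (X_sub_C_ne_zero a))
  have hnum : derivative f * ((X - C a) * h) =
      (X - C a) ^ m * ((C (m : E) * g + (X - C a) * derivative g) * h) := by
    rw [hg, derivative_mul, derivative_X_sub_C_pow]
    rcases m with _ | k
    · simp
      ring
    · simp only [Nat.add_sub_cancel]
      ring
  have hden : f * derivative ((X - C a) * h) =
      (X - C a) ^ m * (g * derivative ((X - C a) * h)) := by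
    rw [← mul_assoc, ← hg]
  rw [hnum, hden, map_mul _ ((X - C a) ^ m), map_mul _ ((X - C a) ^ m),
    mul_div_mul_left _ _ hpow]
  have hne : (g * derivative ((X - C a) * h)).eval a ≠ 0 := by
    rw [eval_mul]
    exact mul_ne_zero hga hq'
  obtain ⟨h₁, h₂⟩ := Polynomial.ratFuncEval_div_of_eval_ne_zero a
    ((C (m : E) * g + (X - C a) * derivative g) * h) _ hne
  refine ⟨h₁, h₂.trans ?_⟩
  rw [div_eq_iff hne, eval_mul, eval_mul, hh]
  simp
  ring

/-- residues of logarithmic derivatives. With `ζ` a primitive `p^n`-th root of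
unity and `Q_n(X) = ((1+X)^{p^n}-1)/((1+X)^{p^{n-1}}-1)`, for any nonzero polynomial `f`
the rational function `(f'·Q_n)/(f·Q_n')` has no pole at `ζ - 1` and its value there is the
multiplicity of `ζ - 1` as a root of `f`. -/
theorem stmt14 (p : ℕ) (hp : p.Prime) (n : ℕ) (hn : 1 ≤ n)
    (E : Type*) [Field E] [CharZero E] (ζ : E) (hζ : IsPrimitiveRoot ζ (p ^ n))
    (Qn : Polynomial E)
    (hQ : Qn * ((1 + Polynomial.X) ^ p ^ (n - 1) - 1) = (1 + Polynomial.X) ^ p ^ n - 1)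
    (f : Polynomial E) (hf : f ≠ 0) :
    Polynomial.eval (ζ - 1) (Polynomial.derivative Qn) ≠ 0 ∧
    ∀ r : RatFunc E,
      r = algebraMap (Polynomial E) (RatFunc E) (Polynomial.derivative f * Qn) /
          algebraMap (Polynomial E) (RatFunc E) (f * Polynomial.derivative Qn) →
      Polynomial.eval (ζ - 1) r.denom ≠ 0 ∧
      RatFunc.eval (RingHom.id E) (ζ - 1) r =
        (Polynomial.rootMultiplicity (ζ - 1) f : E) := by
  have hlt : p ^ (n - 1) < p ^ n := Nat.pow_lt_pow_right hp.one_lt (by omega)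
  have hd : ζ ^ p ^ (n - 1) - 1 ≠ 0 :=
    sub_ne_zero.mpr (hζ.pow_ne_one_of_pos_of_lt (pow_ne_zero _ hp.ne_zero) hlt)
  have hroot : Qn.eval (ζ - 1) = 0 := by
    have := congrArg (Polynomial.eval (ζ - 1)) hQ
    simpa [hζ.pow_eq_one, hd] using this
  have hderiv : (Polynomial.derivative Qn).eval (ζ - 1) ≠ 0 := by
    intro h
    have := congrArg (fun q => (Polynomial.derivative q).eval (ζ - 1)) hQ
    simp [Polynomial.derivative_pow, hroot, h, hp.ne_zero,
      hζ.ne_zero (pow_ne_zero _ hp.ne_zero)] at this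
  refine ⟨hderiv, ?_⟩
  rintro r rfl
  exact Polynomial.ratFuncEval_logDeriv_div_logDeriv (ζ - 1) f Qn hf hroot hderiv
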